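/- For every odd natural number n, the group cohomology H^n(Σ₃; ℤ) is zero. -/

import Mathlib

open CategoryTheory Limits

namespace Rep

universe u

variable {k G : Type u} [CommRing k] [Group G]

attribute [local instance] Subgroup.fintypeQuotientOfFiniteIndex

/-- The linear map `Coind_S^G(Res A) → A` sending `f` to `∑ g⁻¹ • f(g)`, the sum being over the
right cosets `Sg` of a finite index subgroup `S`. -/
noncomputable def coindTrace (S : Subgroup G) [S.FiniteIndex] (A : Rep.{u} k G) :
    coind S.subtype (res S.subtype A) →ₗ[k] A where
  toFun f := ∑ q : Quotient (QuotientGroup.rightRel S),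
    Quotient.liftOn q (fun g => A.ρ g⁻¹ (f.1 g)) fun g₁ g₂ ⟨s, hs⟩ => by
      have hs' : g₁ = s * g₂ := hs.symm
      have h : f.1 (s * g₂) = A.ρ s (f.1 g₂) := f.2 s g₂
      simp only [hs', h, ← Module.End.mul_apply, ← map_mul]
      simp
  map_add' _ _ := by
    rw [← Finset.sum_add_distrib]
    exact Finset.sum_congr rfl fun q _ => Quotient.inductionOn q fun _ => map_add _ _ _
  map_smul' _ _ := by
    rw [Finset.smul_sum]
    exact Finset.sum_congr rfl fun q _ => Quotient.inductionOn q fun _ => map_smul _ _ _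

/-- Right translation by `x` as a permutation of the right cosets of `S`. -/
def rightCosetEquiv (S : Subgroup G) (x : G) :
    Quotient (QuotientGroup.rightRel S) ≃ Quotient (QuotientGroup.rightRel S) :=
  Quotient.congr (Equiv.mulRight x) fun a b => by
    simp [QuotientGroup.rightRel_apply, mul_assoc]

/-- `coindTrace` as a morphism of representations. -/
noncomputable def coindTraceHom (S : Subgroup G) [S.FiniteIndex] (A : Rep.{u} k G) :
    coind S.subtype (res S.subtype A) ⟶ A :=
  ofHom ⟨coindTrace S A, fun x => by
    refine LinearMap.ext fun f => ?_
    simp only [coindTrace, LinearMap.comp_apply, LinearMap.coe_mk, AddHom.coe_mk, map_sum]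
    refine Fintype.sum_equiv (rightCosetEquiv S x) _ _ fun q => Quotient.inductionOn q fun g => ?_
    change A.ρ g⁻¹ (f.1 (g * x)) = A.ρ x (A.ρ (g * x)⁻¹ (f.1 (g * x)))
    rw [← Module.End.mul_apply, ← map_mul]
    simp⟩

lemma resCoindToHom_comp_coindTraceHom (S : Subgroup G) [S.FiniteIndex] (A : Rep.{u} k G) :
    resCoindToHom S.subtype A (res S.subtype A) (𝟙 _) ≫ coindTraceHom S A = S.index • 𝟙 A := by
  ext a
  change ∑ q : Quotient (QuotientGroup.rightRel S), Quotient.liftOn q _ _ =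
    (S.index • 𝟙 A : A ⟶ A).hom a
  trans ∑ q : Quotient (QuotientGroup.rightRel S), a
  · refine Finset.sum_congr rfl fun q _ => Quotient.inductionOn q fun g => ?_
    change A.ρ g⁻¹ (A.ρ g a) = a
    simp
  · rw [Finset.sum_const, Finset.card_univ, ← Nat.card_eq_fintype_card,
      Nat.card_congr (QuotientGroup.quotientRightRelEquivQuotientLeftRel S), nsmul_hom, Representation.IntertwiningMap.coe_nsmul]
    rfl

end Rep

namespace groupCohomology

universe u

variable {k G : Type u} [CommRing k]

instance [Group G] (n : ℕ) : (functor k G n).Additive :=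
  inferInstanceAs (cochainsFunctor k G ⋙ HomologicalComplex.homologyFunctor _ _ n).Additive

/-- If `Hⁿ(S, A)` vanishes, then `Hⁿ(G, A)` is annihilated by the index of `S`. -/
theorem index_smul_eq_zero [Group G] (S : Subgroup G) [S.FiniteIndex] (A : Rep.{u} k G) (n : ℕ)
    (h : IsZero (groupCohomology (Rep.res S.subtype A) n)) (x : groupCohomology A n) :
    S.index • x = 0 := by
  have h' : IsZero ((functor k G n).obj (Rep.coind S.subtype (Rep.res S.subtype A))) :=
    h.of_iso (coindIso _ n)
  have key : (functor k G n).map (S.index • 𝟙 A) = 0 := by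
    rw [← Rep.resCoindToHom_comp_coindTraceHom, Functor.map_comp,
      h'.eq_zero_of_tgt ((functor k G n).map (Rep.resCoindToHom _ _ _ _)), zero_comp]
  rw [Functor.map_nsmul, CategoryTheory.Functor.map_id] at key
  exact congrArg (fun φ => φ.hom x) key

/-- The odd cohomology of a finite cyclic group with coefficients in a trivial module without
torsion of order dividing the order of the group vanishes. -/
theorem isZero_of_isCyclic_of_odd [CommGroup G] [Fintype G] [IsCyclic G] (A : Rep.{u} k G)
    [A.IsTrivial] (hA : ∀ a : A, Fintype.card G • a = 0 → a = 0) (n : ℕ) (hn : Odd n) :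
    IsZero (groupCohomology A n) := by
  obtain ⟨g, hg⟩ := IsCyclic.exists_generator (α := G)
  refine IsZero.of_iso ?_ (Rep.FiniteCyclicGroup.groupCohomologyIsoOdd A g hg n hn)
  rw [← ShortComplex.exact_iff_isZero_homology, ShortComplex.moduleCat_exact_iff]
  intro a ha
  refine ⟨0, ?_⟩
  rw [map_zero]
  refine (hA a ?_).symm
  rw [← ha]
  change _ = A.ρ.norm a
  simp [Representation.norm]

/-- The index of a cyclic subgroup annihilates the odd cohomology of a finite group with
coefficients in a torsion-free trivial module. -/
theorem index_zpowers_smul_eq_zero [Group G] [Finite G] (A : Rep.{u} k G) [A.IsTrivial]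
    (hA : ∀ m : ℕ, m ≠ 0 → ∀ a : A, m • a = 0 → a = 0) (g : G) (n : ℕ) (hn : Odd n)
    (x : groupCohomology A n) : (Subgroup.zpowers g).index • x = 0 := by
  refine index_smul_eq_zero _ A n ?_ x
  let : CommGroup (Subgroup.zpowers g) := IsCyclic.commGroup
  let := Fintype.ofFinite (Subgroup.zpowers g)
  have : (Rep.res (Subgroup.zpowers g).subtype A).IsTrivial :=
    ⟨fun h => A.ρ.isTrivial_def h⟩
  exact isZero_of_isCyclic_of_odd _ (fun a => hA _ Fintype.card_ne_zero a) n hn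

end groupCohomology

/-- For every odd natural number `n`, the group cohomology `H^n(Σ₃; ℤ)` (with trivial
action on `ℤ`) is zero. -/
theorem groupCohomology_sigma3_odd_eq_zero (n : ℕ) (hn : Odd n) :
    Subsingleton (groupCohomology (Rep.trivial ℤ (Equiv.Perm (Fin 3)) ℤ) n) := by
  refine subsingleton_of_forall_eq 0 fun x => ?_
  have key (g : Equiv.Perm (Fin 3)) : (Subgroup.zpowers g).index • x = 0 :=
    groupCohomology.index_zpowers_smul_eq_zero _
      (fun m hm (a : ℤ) h => by simpa [hm] using h) g n hn x
  have hG : Nat.card (Equiv.Perm (Fin 3)) = 6 := by simp [Fintype.card_perm, Nat.factorial]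
  have h₂ : (Subgroup.zpowers (Equiv.swap (0 : Fin 3) 1)).index = 3 := by
    have := (Subgroup.zpowers (Equiv.swap (0 : Fin 3) 1)).card_mul_index
    rw [Nat.card_zpowers, orderOf_eq_prime (p := 2) (by decide) (by decide)] at this
    omega
  have h₃ : (Subgroup.zpowers (finRotate 3)).index = 2 := by
    have := (Subgroup.zpowers (finRotate 3)).card_mul_index
    rw [Nat.card_zpowers, orderOf_eq_prime (p := 3) (by decide) (by decide)] at this
    omega
  have e₂ := key (Equiv.swap 0 1)
  have e₃ := key (finRotate 3)
  rw [h₂] at e₂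
  rw [h₃] at e₃
  rw [succ_nsmul, e₃, zero_add] at e₂
  exact e₂
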